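/- Let T ≠ 0 and C be real constants, let U ⊆ ℝ³ be open, let ω⁰, ω¹, ω² : U → (ℝ³)* be smooth 1-forms that are linearly independent at every point of U, and let ε : U → ℝ be smooth, satisfying on U the structure equations dω⁰ = −T ω⁰∧ω¹, dω¹ = −4T ω⁰∧ω², dω² = ω⁰∧ω¹ + 2ε ω⁰∧ω² − T ω¹∧ω², and dε = P ω⁰ − Tε ω¹ + C ω² for some smooth P : U → ℝ. Then every point of U has an open neighborhood on which there exist smooth real-valued functions u, w, x and smooth real functions f, f₁ of one variable such that ω⁰ = e^{2Tw} du, ω¹ = 2 dw + 4Tx du, ω² = e^{−2Tw}(dx + a du) with a = (1 − e^{4Tw})/(2T) + (2T² − C)x² − 2x f(u) + f₁(u), and ε = e^{−2Tw}(C x + f(u)). (Here du, dw, dx denote the exterior derivatives of the functions u, w, x.) -/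

import Mathlib

open Real

/-- Points of `ℝ³`. -/
abbrev Pt : Type := Fin 3 → ℝ

/-- A 1-form on an open set of `ℝ³`: a field of continuous linear functionals. -/
abbrev OneForm : Type := Pt → (Pt →L[ℝ] ℝ)

/-- The exterior derivative of a 1-form, via the Fréchet derivative:
`dω_p(X,Y) = (Dω_p X)(Y) − (Dω_p Y)(X)`. -/
noncomputable def extd (ω : OneForm) (p : Pt) (X Y : Pt) : ℝ :=
  fderiv ℝ ω p X Y - fderiv ℝ ω p Y X

/-- The wedge of two 1-forms: `(ω∧σ)_p(X,Y) = ω_p(X)σ_p(Y) − ω_p(Y)σ_p(X)`. -/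
def wedge (ω σ : OneForm) (p : Pt) (X Y : Pt) : ℝ :=
  ω p X * σ p Y - ω p Y * σ p X

section LocalIntegration

open Set Filter Topology
open scoped ContDiff unitInterval

section Nemytskii

variable {K E F : Type} [TopologicalSpace K] [CompactSpace K]
  [NormedAddCommGroup E] [NormedSpace ℝ E] [NormedAddCommGroup F] [NormedSpace ℝ F]

/-- Pointwise evaluation of a continuous family of linear maps on a continuous family of vectors. -/
noncomputable def pointwiseApply : C(K, E →L[ℝ] F) →L[ℝ] C(K, E) →L[ℝ] C(K, F) :=
  LinearMap.mkContinuous₂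
    (LinearMap.mk₂ ℝ
      (fun (A : C(K, E →L[ℝ] F)) (γ : C(K, E)) =>
        (⟨fun t => A t (γ t), A.continuous.clm_apply γ.continuous⟩ : C(K, F)))
      (fun A B γ => by ext; simp) (fun c A γ => by ext; simp)
      (fun A γ δ => by ext; simp) (fun c A γ => by ext; simp)) 1
    (fun A γ => by
      rw [one_mul]
      refine (ContinuousMap.norm_le _ (by positivity)).2 fun t => ?_
      exact (A t).le_of_opNorm_le_of_le (A.norm_coe_le_norm t) (γ.norm_coe_le_norm t))

@[simp] lemma pointwiseApply_apply (A : C(K, E →L[ℝ] F)) (γ : C(K, E)) (t : K) :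
    pointwiseApply A γ t = A t (γ t) := rfl

/-- Postcomposition with a `C¹` map is differentiable on the space of continuous maps. -/
lemma hasFDerivAt_postcomp {g : E → F} {g' : E → E →L[ℝ] F} (hg : ∀ y, HasFDerivAt g (g' y) y)
    (hc : Continuous g) (hc' : Continuous g') (γ : C(K, E)) :
    HasFDerivAt (fun γ : C(K, E) => (⟨g, hc⟩ : C(E, F)).comp γ)
      (pointwiseApply ((⟨g', hc'⟩ : C(E, E →L[ℝ] F)).comp γ)) γ := by
  rw [hasFDerivAt_iff_isLittleO, Asymptotics.isLittleO_iff]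
  intro c hcpos
  have hS := (ContinuousMap.continuous_postcomp (X := K) (⟨g', hc'⟩ : C(E, E →L[ℝ] F))).tendsto γ
  obtain ⟨r, hr, hball⟩ := Metric.eventually_nhds_iff_ball.1 (hS
    (Metric.ball_mem_nhds ((⟨g', hc'⟩ : C(E, E →L[ℝ] F)).comp γ) hcpos))
  filter_upwards [Metric.ball_mem_nhds γ hr] with δ hδ
  refine (ContinuousMap.norm_le _ (by positivity)).2 fun t => ?_
  have key : ‖g (δ t) - g (γ t) - g' (γ t) (δ t - γ t)‖ ≤ c * ‖δ t - γ t‖ := by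
    refine (convex_segment (γ t) (δ t)).norm_image_sub_le_of_norm_hasFDerivWithin_le'
      (f' := g') (fun z _ => (hg z).hasFDerivWithinAt) ?_
      (left_mem_segment ℝ _ _) (right_mem_segment ℝ _ _)
    intro z hz
    rw [segment_eq_image'] at hz
    obtain ⟨s, hs, rfl⟩ := hz
    have hmem : γ + s • (δ - γ) ∈ Metric.ball γ r := by
      rw [Metric.mem_ball, dist_eq_norm] at hδ ⊢
      rw [add_sub_cancel_left, norm_smul, Real.norm_of_nonneg hs.1]
      exact (mul_le_of_le_one_left (norm_nonneg _) hs.2).trans_lt hδ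
    have h := (ContinuousMap.dist_apply_le_dist t).trans (hball _ hmem).le
    simpa [dist_eq_norm] using h
  refine key.trans ?_
  gcongr
  exact (δ - γ).norm_coe_le_norm t

lemma contDiff_postcomp_nat (n : ℕ) : ∀ {F : Type} [NormedAddCommGroup F] [NormedSpace ℝ F]
    {g : E → F} (hg : ContDiff ℝ n g),
    ContDiff ℝ n (fun γ : C(K, E) => (⟨g, hg.continuous⟩ : C(E, F)).comp γ) := by
  induction n with
  | zero =>
    intro F _ _ g hg
    exact contDiff_zero.2 (ContinuousMap.continuous_postcomp _)
  | succ n ih =>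
    intro F _ _ g hg
    have hg' : ContDiff ℝ n (fderiv ℝ g) := hg.fderiv_right (by norm_cast)
    refine contDiff_succ_iff_hasFDerivAt.2
      ⟨fun γ => pointwiseApply ((⟨fderiv ℝ g, hg'.continuous⟩ : C(E, E →L[ℝ] F)).comp γ),
        (ContinuousLinearMap.contDiff _).comp (ih hg'), fun γ => ?_⟩
    exact hasFDerivAt_postcomp
      (fun y => (hg.differentiable (by norm_cast) y).hasFDerivAt) _ _ γ

/-- Postcomposition with a smooth map is smooth on the space of continuous maps. -/
lemma contDiff_postcomp {g : E → F} (hg : ContDiff ℝ ∞ g) :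
    ContDiff ℝ ∞ (fun γ : C(K, E) => (⟨g, hg.continuous⟩ : C(E, F)).comp γ) :=
  contDiff_infty.2 fun n => contDiff_postcomp_nat n (hg.of_le (by exact_mod_cast le_top))

end Nemytskii

section Implicit

variable {E₁ E₂ F : Type} [NormedAddCommGroup E₁] [NormedSpace ℝ E₁] [CompleteSpace E₁]
  [NormedAddCommGroup E₂] [NormedSpace ℝ E₂] [CompleteSpace E₂]
  [NormedAddCommGroup F] [NormedSpace ℝ F] [CompleteSpace F]

/-- A form of the implicit function theorem in which the implicit function is smooth on a whole
neighbourhood of the base point. -/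
lemma exists_smooth_implicit {f : E₁ × E₂ → F} {u : E₁ × E₂}
    (hf : ∀ᶠ v in 𝓝 u, ContDiffAt ℝ ∞ f v)
    (hinv : (fderiv ℝ f u ∘L .inr ℝ E₁ E₂).IsInvertible) :
    ∃ ψ : E₁ → E₂, ψ u.1 = u.2 ∧ (∀ᶠ x in 𝓝 u.1, ContDiffAt ℝ ∞ ψ x) ∧
      (∀ᶠ x in 𝓝 u.1, f (x, ψ x) = f u) ∧ ∀ᶠ v in 𝓝 u, f v = f u → ψ v.1 = v.2 := by
  have h1 : ContDiffAt ℝ 1 f u := hf.self_of_nhds.of_le (by simp)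
  set ψ := h1.implicitFunction one_ne_zero hinv with hψ
  have hself : ψ u.1 = u.2 := h1.implicitFunction_apply_self one_ne_zero hinv
  have heq : ∀ᶠ x in 𝓝 u.1, f (x, ψ x) = f u :=
    h1.eventually_apply_implicitFunction one_ne_zero hinv
  have hiff := h1.eventually_apply_eq_iff_implicitFunction one_ne_zero hinv
  have hψ1 : ContDiffAt ℝ 1 ψ u.1 := h1.contDiffAt_implicitFunction one_ne_zero hinv
  refine ⟨ψ, hself, ?_, heq, hiff.mono fun v hv => hv.1⟩
  have hcont : Tendsto (fun x => (x, ψ x)) (𝓝 u.1) (𝓝 u) := by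
    have := (continuousAt_id (x := u.1)).prodMk hψ1.continuousAt
    simpa [ContinuousAt, hself] using this
  have hinv' : ∀ᶠ v in 𝓝 u, (fderiv ℝ f v ∘L .inr ℝ E₁ E₂).IsInvertible := by
    have hc : ContinuousAt (fun v => fderiv ℝ f v ∘L .inr ℝ E₁ E₂) u :=
      (h1.continuousAt_fderiv one_ne_zero).clm_comp continuousAt_const
    obtain ⟨A, hA⟩ := hinv
    have hn := ContinuousLinearEquiv.nhds A
    rw [hA] at hn
    filter_upwards [hc hn] with v hv
    obtain ⟨B, hB⟩ := hv
    exact ⟨B, hB⟩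
  filter_upwards [hcont.eventually hf, hcont.eventually hinv', heq.eventually_nhds,
    (hψ1.eventually (by simp))] with x hfx hix heqx hcx
  have hm := hfx.eventually_apply_eq_iff_implicitFunction (by simp) hix
  have hc : Tendsto (fun y => (y, ψ y)) (𝓝 x) (𝓝 (x, ψ x)) :=
    continuousAt_id.prodMk hcx.continuousAt
  refine (hfx.contDiffAt_implicitFunction (by simp) hix).congr_of_eventuallyEq ?_
  filter_upwards [hc.eventually hm, heqx] with y hy hy'
  exact (hy.1 (hy'.trans heqx.self_of_nhds.symm)).symm

end Implicit

section Flow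

variable {E : Type} [NormedAddCommGroup E] [NormedSpace ℝ E]

/-- The primitive of a curve on `[0, 1]`, vanishing at `0`. -/
noncomputable def primitive : C(I, E) →L[ℝ] C(I, E) :=
  LinearMap.mkContinuous
    { toFun := fun f =>
        (⟨fun t => ∫ s in (0 : ℝ)..t, f (projIcc 0 1 zero_le_one s),
          (intervalIntegral.continuous_primitive
            (fun _ _ => (f.continuous.comp continuous_projIcc).intervalIntegrable _ _) 0).comp
            continuous_subtype_val⟩ : C(I, E))
      map_add' := fun f g => by
        ext t
        exact intervalIntegral.integral_add
          ((f.continuous.comp continuous_projIcc).intervalIntegrable _ _)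
          ((g.continuous.comp continuous_projIcc).intervalIntegrable _ _)
      map_smul' := fun c f => by
        ext t
        exact intervalIntegral.integral_smul c _ } 1
    (fun f => by
      refine (ContinuousMap.norm_le _ (by positivity)).2 fun t => ?_
      refine (intervalIntegral.norm_integral_le_of_norm_le_const (C := ‖f‖)
        fun s _ => f.norm_coe_le_norm _).trans ?_
      rw [sub_zero, abs_of_nonneg t.2.1, one_mul]
      exact mul_le_of_le_one_right (norm_nonneg _) t.2.2)

lemma primitive_apply (f : C(I, E)) (t : I) :
    primitive f t = ∫ s in (0 : ℝ)..t, f (projIcc 0 1 zero_le_one s) := rfl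

/-- Constant curves, as a continuous linear map. -/
noncomputable def constCurve : E →L[ℝ] C(I, E) :=
  LinearMap.mkContinuous
    { toFun := fun q => ContinuousMap.const I q
      map_add' := fun _ _ => rfl
      map_smul' := fun _ _ => rfl } 1
    (fun q => by
      rw [one_mul]
      exact (ContinuousMap.norm_le _ (norm_nonneg _)).2 fun t => le_rfl)

@[simp] lemma constCurve_apply (q : E) (t : I) : constCurve q t = q := rfl

/-- Pairing of a curve with a constant one, as a continuous linear map. -/
noncomputable def curvePair : E × C(I, E) →L[ℝ] C(I, E × E) :=
  ContinuousLinearMap.compLeftContinuous ℝ I (.inl ℝ E E) ∘L .snd ℝ E C(I, E) +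
    ContinuousLinearMap.compLeftContinuous ℝ I (.inr ℝ E E) ∘L constCurve ∘L .fst ℝ E C(I, E)

@[simp] lemma curvePair_apply (v : E × C(I, E)) (t : I) : curvePair v t = (v.2 t, v.1) := by
  simp [curvePair]

/-- Smooth dependence on the parameter `q` of the solution of the integral equation
`γ t = q - ∫₀ᵗ W (γ s, q) ds`, near a parameter `p` for which `W` vanishes, together with the
variational equation. -/
lemma exists_smooth_flow [CompleteSpace E] {W : E × E → E} (hW : ContDiff ℝ ∞ W) (p : E)
    (hp : ∀ z, W (z, p) = 0) :
    ∃ Γ : E → C(I, E), Γ p = constCurve p ∧ ∀ᶠ q in 𝓝 p, ContDiffAt ℝ ∞ Γ q ∧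
      (∀ t : I, Γ q t = q - ∫ s in (0 : ℝ)..t, W (Γ q (projIcc 0 1 zero_le_one s), q)) ∧
      ∀ (X : E) (t : I), fderiv ℝ Γ q X t = X - ∫ s in (0 : ℝ)..t,
        fderiv ℝ W (Γ q (projIcc 0 1 zero_le_one s), q)
          (fderiv ℝ Γ q X (projIcc 0 1 zero_le_one s), X) := by
  have hW' : ContDiff ℝ ∞ (fderiv ℝ W) := hW.fderiv_right (by simp)
  set N : C(I, E × E) → C(I, E) := fun γ => (⟨W, hW.continuous⟩ : C(E × E, E)).comp γ with hN
  have hNs : ContDiff ℝ ∞ N := contDiff_postcomp hW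
  have hNd : ∀ γ, HasFDerivAt N
      (pointwiseApply ((⟨fderiv ℝ W, hW'.continuous⟩ : C(E × E, E × E →L[ℝ] E)).comp γ)) γ :=
    hasFDerivAt_postcomp (fun y => (hW.differentiable (by simp) y).hasFDerivAt) _ _
  set Φ : E × C(I, E) → C(I, E) := fun v => v.2 - constCurve v.1 + primitive (N (curvePair v))
    with hΦ
  have hΦs : ContDiff ℝ ∞ Φ :=
    (contDiff_snd.sub (constCurve.contDiff.comp contDiff_fst)).add
      (primitive.contDiff.comp (hNs.comp curvePair.contDiff))
  have hΦp : ∀ γ, Φ (p, γ) = γ - constCurve p := by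
    intro γ
    have : N (curvePair (p, γ)) = 0 := by
      ext t
      simp [hN, hp]
    simp [hΦ, this]
  have hder : fderiv ℝ Φ (p, constCurve p) ∘L .inr ℝ E C(I, E) = .id ℝ _ := by
    have h1 : HasFDerivAt (fun γ => Φ (p, γ))
        (fderiv ℝ Φ (p, constCurve p) ∘L .inr ℝ E C(I, E)) (constCurve p) :=
      (hΦs.differentiable (by simp) (p, constCurve p)).hasFDerivAt.comp (constCurve p)
        (hasFDerivAt_prodMk_right p (constCurve p))
    have h2 : HasFDerivAt (fun γ => Φ (p, γ)) (.id ℝ C(I, E)) (constCurve p) := by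
      simp_rw [hΦp]
      exact (hasFDerivAt_id _).sub_const _
    exact h1.unique h2
  obtain ⟨Γ, hΓp, hΓs, hΓ, -⟩ := exists_smooth_implicit (f := Φ) (u := (p, constCurve p))
    (Eventually.of_forall fun v => hΦs.contDiffAt)
    (by rw [hder]; exact ⟨.refl ℝ _, rfl⟩)
  refine ⟨Γ, hΓp, ?_⟩
  filter_upwards [hΓs, hΓ.eventually_nhds] with q hqs hq
  have hfix : ∀ᶠ q' in 𝓝 q, Γ q' = constCurve q' - primitive (N (curvePair (q', Γ q'))) := by
    filter_upwards [hq] with q' hq'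
    rw [hΦp, sub_self] at hq'
    have : Γ q' - constCurve q' + primitive (N (curvePair (q', Γ q'))) = 0 := hq'
    rw [eq_sub_iff_add_eq, ← sub_eq_zero, ← this]
    abel
  refine ⟨hqs, fun t => ?_, fun X t => ?_⟩
  · have := congrArg (fun γ : C(I, E) => γ t) hfix.self_of_nhds
    simpa [primitive_apply, hN] using this
  · have hΓd := (hqs.differentiableAt (by simp)).hasFDerivAt
    have h1 := (constCurve.hasFDerivAt (x := q)).sub
      (primitive.hasFDerivAt.comp q ((hNd _).comp q
        (curvePair.hasFDerivAt.comp q ((hasFDerivAt_id q).prodMk hΓd))))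
    have h2 := hΓd.unique (h1.congr_of_eventuallyEq hfix)
    have := congrArg (fun A : E →L[ℝ] C(I, E) => A X t) h2
    simpa [primitive_apply] using this

end Flow

section FirstIntegral

variable {E F : Type} [NormedAddCommGroup E] [NormedSpace ℝ E] [FiniteDimensional ℝ E]
  [NormedAddCommGroup F] [NormedSpace ℝ F]

/-- The germ of a smooth map extends to a globally smooth map. -/
lemma exists_contDiff_eventuallyEq {h : E → F} {p : E} (hh : ∀ᶠ z in 𝓝 p, ContDiffAt ℝ ∞ h z) :
    ∃ k : E → F, ContDiff ℝ ∞ k ∧ k =ᶠ[𝓝 p] h := by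
  obtain ⟨R, hR, hball⟩ := Metric.eventually_nhds_iff_ball.1 hh
  let b : ContDiffBump p := ⟨R / 4, R / 2, by positivity, by linarith⟩
  refine ⟨fun z => b z • h z, contDiff_iff_contDiffAt.2 fun z => ?_, ?_⟩
  · by_cases hz : z ∈ tsupport b
    · rw [b.tsupport_eq] at hz
      exact b.contDiff.contDiffAt.smul (hball z
        (Metric.closedBall_subset_ball (by change R / 2 < R; linarith) hz))
    · refine contDiffAt_const (c := (0 : F)) |>.congr_of_eventuallyEq ?_
      filter_upwards [notMem_tsupport_iff_eventuallyEq.1 hz] with y hy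
      simp [hy]
  · filter_upwards [b.eventuallyEq_one] with z hz
    simp [hz]

/-- Local Frobenius theorem for a single one-form `α` with `dα = α ∧ β`: near a point there is a
function whose differential vanishes exactly where `α` does. -/
lemma exists_first_integral {α β : E → E →L[ℝ] ℝ} {U : Set E} (hU : IsOpen U)
    (hα : ContDiffOn ℝ ∞ α U) (hβ : ContinuousOn β U)
    (hd : ∀ q ∈ U, ∀ X Y, fderiv ℝ α q X Y - fderiv ℝ α q Y X =
      α q X * β q Y - α q Y * β q X) {p e : E} (hpU : p ∈ U) (he : α p e = 1) :
    ∃ u : E → ℝ, ∀ᶠ q in 𝓝 p, ContDiffAt ℝ ∞ u q ∧ 0 < fderiv ℝ u q e ∧ 0 < α q e ∧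
      ∀ X, α q X = 0 → fderiv ℝ u q X = 0 := by
  have hαat : ∀ q ∈ U, ContDiffAt ℝ ∞ α q := fun q hq => hα.contDiffAt (hU.mem_nhds hq)
  have hpos : ∀ᶠ q in 𝓝 p, 0 < α q e := by
    have hc : ContinuousAt (fun q => α q e) p :=
      (hαat p hpU).continuousAt.clm_apply continuousAt_const
    exact hc.eventually (lt_mem_nhds (by simp [he]))
  obtain ⟨m, hm, hmeq⟩ := exists_contDiff_eventuallyEq (p := p)
    (h := fun z => (α z e)⁻¹ • α z) (by
      filter_upwards [hU.mem_nhds hpU, hpos] with z hz hz'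
      exact (((hαat z hz).clm_apply contDiffAt_const).inv hz'.ne').smul (hαat z hz))
  obtain ⟨r, hr, hball⟩ := Metric.eventually_nhds_iff_ball.1
    ((hU.eventually_mem hpU).and (hpos.and hmeq))
  set pr : E →L[ℝ] E := .id ℝ E - (α p).smulRight e with hpr
  have hpre : pr e = 0 := by simp [hpr, he]
  have hpr_idem : ∀ X, pr (pr X) = pr X := by
    intro X
    simp [hpr, he]
  set W : E × E → E := fun v => pr (v.2 - p) - m v.1 (pr (v.2 - p)) • e with hW
  have hWs : ContDiff ℝ ∞ W := by
    have h1 : ContDiff ℝ ∞ fun v : E × E => pr (v.2 - p) :=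
      pr.contDiff.comp (contDiff_snd.sub contDiff_const)
    exact h1.sub (((hm.comp contDiff_fst).clm_apply h1).smul contDiff_const)
  have hWker : ∀ z ∈ Metric.ball p r, ∀ q, α z (W (z, q)) = 0 := by
    intro z hz q
    obtain ⟨-, h2, h3⟩ := hball z hz
    have h2' := h2.ne'
    simp only [hW, h3, map_sub, map_smul, _root_.smul_apply, smul_eq_mul]
    field_simp
    ring
  obtain ⟨Γ, hΓp, hΓ⟩ := exists_smooth_flow hWs p (fun z => by simp [hW])
  have hprW : ∀ v, pr (W v) = pr (v.2 - p) := by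
    intro v
    simp [hW, hpr_idem, hpre]
  have hnear : ∀ᶠ q in 𝓝 p, ∀ t, Γ q t ∈ Metric.ball p r := by
    have hc : ContinuousAt Γ p := hΓ.self_of_nhds.1.continuousAt
    filter_upwards [hc (Metric.ball_mem_nhds (Γ p) hr)] with q hq t
    rw [Metric.mem_ball]
    refine lt_of_le_of_lt ?_ (Metric.mem_ball.1 hq)
    have := ContinuousMap.dist_apply_le_dist (f := Γ q) (g := Γ p) t
    rwa [hΓp] at this ⊢
  set ev : C(I, E) →L[ℝ] E := ContinuousMap.evalCLM ℝ (1 : I) with hev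
  set u : E → ℝ := fun q => α p (ev (Γ q)) with hu
  have hus : ∀ q, ContDiffAt ℝ ∞ Γ q → ContDiffAt ℝ ∞ u q := fun q hq =>
    (α p ∘L ev).contDiff.contDiffAt.comp q hq
  have hud : ∀ q, ContDiffAt ℝ ∞ Γ q → ∀ X, fderiv ℝ u q X = α p (fderiv ℝ Γ q X 1) := by
    intro q hq X
    have := ((α p ∘L ev).hasFDerivAt.comp q (hq.differentiableAt (by simp)).hasFDerivAt).fderiv
    have h2 : fderiv ℝ u q = _ := this
    rw [h2]
    rfl
  have hWder : ∀ X t, fderiv ℝ W (p, p) (t, X) = pr X - m p (pr X) • e := by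
    intro X t
    have hA : HasFDerivAt (fun v : E × E => pr (v.2 - p)) (pr ∘L .snd ℝ E E) (p, p) :=
      pr.hasFDerivAt.comp (p, p) (hasFDerivAt_snd.sub_const p)
    have hM : HasFDerivAt (fun v : E × E => m v.1) (fderiv ℝ m p ∘L .fst ℝ E E) (p, p) :=
      (hm.differentiable (by simp) p).hasFDerivAt.comp (p, p) hasFDerivAt_fst
    have h := (hA.sub ((hM.clm_apply hA).smul_const e)).fderiv
    have h' : fderiv ℝ W (p, p) = _ := h
    rw [h']
    simp
  have hupos : ∀ᶠ q in 𝓝 p, 0 < fderiv ℝ u q e := by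
    obtain ⟨h1, -, h3⟩ := hΓ.self_of_nhds
    have hc : ContinuousAt (fun q => fderiv ℝ u q e) p :=
      ((hus p h1).fderiv_right (m := ∞) (by simp)).continuousAt.clm_apply continuousAt_const
    refine hc.eventually (lt_mem_nhds ?_)
    change 0 < fderiv ℝ u p e
    rw [hud p h1, h3]
    simp [hΓp, hWder, hpre, he]
  have hend : ∀ᶠ q in 𝓝 p, pr (Γ q 1) = pr p := by
    filter_upwards [hΓ] with q hq
    have h1 := hq.2.1 1
    rw [h1, map_sub, ← pr.intervalIntegral_comp_comm]
    · simp [hprW]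
    · exact (hWs.continuous.comp (((Γ q).continuous.comp continuous_projIcc).prodMk
        continuous_const)).intervalIntegrable _ _
  refine ⟨u, ?_⟩
  filter_upwards [hΓ, hnear, hupos, hpos, hend.eventually_nhds] with q hq hqn hqu hqpos hqe
  obtain ⟨hqs, hγ, hδ⟩ := hq
  refine ⟨hus q hqs, hqu, hqpos, fun X hX => ?_⟩
  rw [hud q hqs]
  set δ : C(I, E) := fderiv ℝ Γ q X with hδdef
  have hδ1 : pr (δ 1) = 0 := by
    have h1 : HasFDerivAt (fun q' => pr (Γ q' 1)) (pr ∘L ev ∘L fderiv ℝ Γ q) q :=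
      (pr ∘L ev).hasFDerivAt.comp q (hqs.differentiableAt (by simp)).hasFDerivAt
    have h2 := h1.unique ((hasFDerivAt_const (pr p) q).congr_of_eventuallyEq hqe)
    have := congrArg (fun A : E →L[ℝ] E => A X) h2
    exact this
  have hδ1' : δ 1 = α p (δ 1) • e := by
    have : δ 1 - α p (δ 1) • e = 0 := hδ1
    exact sub_eq_zero.1 this
  set c : ℝ → I := projIcc 0 1 zero_le_one with hc
  have hcc : Continuous c := continuous_projIcc
  have hWc : Continuous fun s => W (Γ q (c s), q) :=
    hWs.continuous.comp (((Γ q).continuous.comp hcc).prodMk continuous_const)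
  have hDc : Continuous fun s => fderiv ℝ W (Γ q (c s), q) (δ (c s), X) :=
    ((hWs.continuous_fderiv (by simp)).comp
      (((Γ q).continuous.comp hcc).prodMk continuous_const)).clm_apply
      ((δ.continuous.comp hcc).prodMk continuous_const)
  set γ' : ℝ → E := fun t => q - ∫ s in (0 : ℝ)..t, W (Γ q (c s), q) with hγ'
  set δ' : ℝ → E := fun t => X - ∫ s in (0 : ℝ)..t, fderiv ℝ W (Γ q (c s), q) (δ (c s), X)
    with hδ'
  have hcI : ∀ t : I, c t = t := fun t => projIcc_val zero_le_one t
  have hγI : ∀ t ∈ Icc (0 : ℝ) 1, γ' t = Γ q (c t) := by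
    intro t ht
    rw [show c t = ⟨t, ht⟩ from hcI ⟨t, ht⟩]
    exact (hγ ⟨t, ht⟩).symm
  have hδI : ∀ t ∈ Icc (0 : ℝ) 1, δ' t = δ (c t) := by
    intro t ht
    rw [show c t = ⟨t, ht⟩ from hcI ⟨t, ht⟩]
    exact (hδ X ⟨t, ht⟩).symm
  have hγd : ∀ t, HasDerivAt γ' (-W (Γ q (c t), q)) t := fun t =>
    (hWc.integral_hasStrictDerivAt 0 t).hasDerivAt.const_sub q
  have hδd : ∀ t, HasDerivAt δ' (-fderiv ℝ W (Γ q (c t), q) (δ (c t), X)) t := fun t =>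
    (hDc.integral_hasStrictDerivAt 0 t).hasDerivAt.const_sub X
  have hηd : ∀ t ∈ Icc (0 : ℝ) 1, HasDerivAt (fun t => α (γ' t) (δ' t))
      (β (Γ q (c t)) (W (Γ q (c t), q)) * α (γ' t) (δ' t)) t := by
    intro t ht
    set z := Γ q (c t) with hz
    have hzb : z ∈ Metric.ball p r := hqn _
    have hzU := (hball z hzb).1
    have hαd : HasFDerivAt α (fderiv ℝ α z) z :=
      ((hαat z hzU).differentiableAt (by simp)).hasFDerivAt
    have h1 : HasDerivAt (fun t => α (γ' t)) (fderiv ℝ α z (-W (z, q))) t := by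
      exact HasFDerivAt.comp_hasDerivAt t (by rwa [hγI t ht]) (hγd t)
    have h2 := h1.clm_apply (hδd t)
    have h3 : HasFDerivAt (fun v : E × E => α v.1 (W v)) _ (z, q) :=
      (hαd.comp (z, q) (hasFDerivAt_fst (p := (z, q)))).clm_apply
        (hWs.differentiable (by simp) (z, q)).hasFDerivAt
    have h4 := h3.unique ((hasFDerivAt_const (0 : ℝ) (z, q)).congr_of_eventuallyEq (by
      filter_upwards [continuousAt_fst.eventually (Metric.isOpen_ball.mem_nhds hzb)] with v hv
      exact hWker v.1 hv v.2))
    have h5 := congrArg (fun A : E × E →L[ℝ] ℝ => A (δ (c t), X)) h4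
    have h6 := hd z hzU (W (z, q)) (δ (c t))
    have h7 := hWker z hzb q
    refine h2.congr_deriv ?_
    rw [hγI t ht, hδI t ht]
    simp at h5 ⊢
    rw [h7] at h6
    linear_combination -h6 - h5
  have hKc : Continuous fun t => β (Γ q (c t)) (W (Γ q (c t), q)) :=
    (hβ.comp_continuous ((Γ q).continuous.comp hcc)
      (fun t => (hball _ (hqn _)).1)).clm_apply hWc
  obtain ⟨K, hK⟩ := isCompact_Icc.exists_bound_of_continuousOn (s := Icc (0 : ℝ) 1)
    hKc.continuousOn
  have hη := eq_zero_of_abs_deriv_le_mul_abs_self_of_eq_zero_right (K := K)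
    (fun t ht => (hηd t ht).continuousAt.continuousWithinAt)
    (fun t ht => (hηd t (Ico_subset_Icc_self ht)).hasDerivWithinAt)
    (by simp [hγ', hδ', hX])
    (fun t ht => by
      rw [norm_mul]
      exact mul_le_mul_of_nonneg_right (hK t (Ico_subset_Icc_self ht)) (norm_nonneg _))
    1 (right_mem_Icc.2 zero_le_one)
  simp only [hγI 1 (right_mem_Icc.2 zero_le_one), hδI 1 (right_mem_Icc.2 zero_le_one)] at hη
  rw [show c 1 = 1 from hcI 1, hδ1', map_smul, smul_eq_mul] at hη
  exact (mul_eq_zero.1 hη).resolve_right (hball _ (hqn 1)).2.1.ne'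

end FirstIntegral

section FunctionalDependence

variable {E : Type} [NormedAddCommGroup E] [NormedSpace ℝ E] [FiniteDimensional ℝ E]

/-- A smooth function whose differential is everywhere a multiple of that of a submersion `u` is
locally a smooth function of `u`. -/
lemma exists_eventually_eq_comp {u F : E → ℝ} {p e : E}
    (hu : ∀ᶠ q in 𝓝 p, ContDiffAt ℝ ∞ u q) (hF : ∀ᶠ q in 𝓝 p, ContDiffAt ℝ ∞ F q)
    (hker : ∀ᶠ q in 𝓝 p, ∀ X, fderiv ℝ u q X = 0 → fderiv ℝ F q X = 0)
    (he : fderiv ℝ u p e = 1) :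
    ∃ f : ℝ → ℝ, ContDiff ℝ ∞ f ∧ ∀ᶠ q in 𝓝 p, F q = f (u q) := by
  have : CompleteSpace E := FiniteDimensional.complete ℝ E
  set l : E →L[ℝ] ℝ := fderiv ℝ u p with hl
  set Ψ : E → E := fun q => q + (u q - l q) • e with hΨ
  have hlΨ : ∀ q, l (Ψ q) = u q := fun q => by simp [hΨ, he]
  have hΨs : ∀ᶠ q in 𝓝 p, ContDiffAt ℝ ∞ Ψ q := hu.mono fun q hq =>
    contDiffAt_id.add ((hq.sub l.contDiff.contDiffAt).smul contDiffAt_const)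
  have hΨd : HasFDerivAt Ψ (.id ℝ E) p := by
    have h1 : HasFDerivAt u l p := (hu.self_of_nhds.differentiableAt (by simp)).hasFDerivAt
    refine ((hasFDerivAt_id p).add ((h1.sub l.hasFDerivAt).smul_const e)).congr_fderiv ?_
    ext X
    simp
  set Φ : E × E → E := fun v => Ψ v.2 - v.1 with hΦ
  have hΦs : ∀ᶠ v in 𝓝 (Ψ p, p), ContDiffAt ℝ ∞ Φ v := by
    filter_upwards [continuousAt_snd.eventually (show ∀ᶠ q in 𝓝 (Ψ p, p).2, _ from hΨs)]
      with v hv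
    exact (hv.comp v contDiffAt_snd).sub contDiffAt_fst
  have hder : fderiv ℝ Φ (Ψ p, p) ∘L .inr ℝ E E = .id ℝ E := by
    have h1 : HasFDerivAt (fun q => Φ (Ψ p, q)) (fderiv ℝ Φ (Ψ p, p) ∘L .inr ℝ E E) p :=
      (hΦs.self_of_nhds.differentiableAt (by simp)).hasFDerivAt.comp p
        (hasFDerivAt_prodMk_right (Ψ p) p)
    exact h1.unique (hΨd.sub_const (Ψ p))
  obtain ⟨ψ, hψp, hψs, hψ, hψ'⟩ := exists_smooth_implicit hΦs
    (by rw [hder]; exact ⟨.refl ℝ _, rfl⟩)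
  simp only [hΦ, sub_self, sub_eq_zero] at hψp hψs hψ hψ'
  have hψt : Tendsto ψ (𝓝 (Ψ p)) (𝓝 p) := by
    have := hψs.self_of_nhds.continuousAt.tendsto
    rwa [hψp] at this
  have huψ : ∀ᶠ y in 𝓝 (Ψ p), u (ψ y) = l y := hψ.mono fun y hy => by rw [← hlΨ, hy]
  have hH : ∀ᶠ y in 𝓝 (Ψ p), ContDiffAt ℝ ∞ (F ∘ ψ) y ∧
      ∀ X, l X = 0 → fderiv ℝ (F ∘ ψ) y X = 0 := by
    filter_upwards [hψs, hψt.eventually hF, hψt.eventually hu, hψt.eventually hker,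
      huψ.eventually_nhds] with y h1 h2 h3 h4 h5
    refine ⟨h2.comp y h1, fun X hX => ?_⟩
    have hd1 := (h1.differentiableAt (by simp)).hasFDerivAt
    rw [((h2.differentiableAt (by simp)).hasFDerivAt.comp y hd1).fderiv]
    refine h4 _ ?_
    have h6 := ((h3.differentiableAt (by simp)).hasFDerivAt.comp y hd1).unique
      (l.hasFDerivAt.congr_of_eventuallyEq h5)
    have h7 := congrArg (fun A : E →L[ℝ] ℝ => A X) h6
    exact h7.trans hX
  obtain ⟨r, hr, hball⟩ := Metric.eventually_nhds_iff_ball.1 hH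
  set ρ : ℝ → E := fun s => Ψ p + (s - u p) • e with hρ
  have hρs : ContDiff ℝ ∞ ρ :=
    contDiff_const.add ((contDiff_id.sub contDiff_const).smul contDiff_const)
  have hρp : ρ (u p) = Ψ p := by simp [hρ]
  have hρt : Tendsto ρ (𝓝 (u p)) (𝓝 (Ψ p)) := by
    have := hρs.continuous.tendsto (u p)
    rwa [hρp] at this
  obtain ⟨f, hf, hfeq⟩ := exists_contDiff_eventuallyEq (p := u p) (h := F ∘ ψ ∘ ρ) (by
    filter_upwards [hρt.eventually hH] with s hs
    exact hs.1.comp s hρs.contDiffAt)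
  refine ⟨f, hf, ?_⟩
  have hΨt : Tendsto Ψ (𝓝 p) (𝓝 (Ψ p)) := hΨd.continuousAt
  have hut : Tendsto u (𝓝 p) (𝓝 (u p)) := hu.self_of_nhds.continuousAt
  have hinv : Tendsto (fun q => (Ψ q, q)) (𝓝 p) (𝓝 (Ψ p, p)) :=
    hΨt.prodMk_nhds tendsto_id
  filter_upwards [hinv.eventually hψ', hut.eventually hfeq,
    hΨt.eventually (Metric.ball_mem_nhds _ hr),
    (hρt.comp hut).eventually (Metric.ball_mem_nhds _ hr)] with q h1 h2 h3 h4
  rw [h2]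
  change F q = (F ∘ ψ) (ρ (u q))
  nth_rewrite 1 [← h1 rfl]
  change (F ∘ ψ) (Ψ q) = _
  change Ψ q ∈ Metric.ball (Ψ p) r at h3
  change ρ (u q) ∈ Metric.ball (Ψ p) r at h4
  set D := ρ (u q) - Ψ q with hD
  have hlD : l D = 0 := by
    simp [hD, hρ, hlΨ, he]
  have hmem : ∀ t ∈ Icc (0 : ℝ) 1, Ψ q + t • D ∈ Metric.ball (Ψ p) r := fun t ht =>
    (convex_ball (Ψ p) r).add_smul_sub_mem h3 h4 ht
  have hd : ∀ t ∈ Icc (0 : ℝ) 1, HasDerivAt (fun t : ℝ => (F ∘ ψ) (Ψ q + t • D)) 0 t := by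
    intro t ht
    obtain ⟨h5, h6⟩ := hball _ (hmem t ht)
    have h7 : HasDerivAt (fun t : ℝ => Ψ q + t • D) D t := by
      simpa using ((hasDerivAt_id t).smul_const D).const_add (Ψ q)
    have h8 := (h5.differentiableAt (by simp)).hasFDerivAt.comp_hasDerivAt t h7
    rwa [h6 D hlD] at h8
  have := constant_of_has_deriv_right_zero
    (fun t ht => (hd t ht).continuousAt.continuousWithinAt)
    (fun t ht => (hd t (Ico_subset_Icc_self ht)).hasDerivWithinAt) 1
    (right_mem_Icc.2 zero_le_one)
  simpa [hD] using this.symm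

end FunctionalDependence

section ExteriorDerivative

lemma extd_add {α β : OneForm} {q : Pt} (hα : DifferentiableAt ℝ α q)
    (hβ : DifferentiableAt ℝ β q) (X Y : Pt) :
    extd (fun z => α z + β z) q X Y = extd α q X Y + extd β q X Y := by
  simp only [extd, fderiv_fun_add hα hβ, add_apply]
  ring

lemma differentiableAt_smul_fderiv {k v : Pt → ℝ} {q : Pt} (hk : DifferentiableAt ℝ k q)
    (hv : ContDiffAt ℝ ∞ v q) : DifferentiableAt ℝ (fun z => k z • fderiv ℝ v z) q :=
  hk.smul ((hv.fderiv_right (m := ∞) (by simp)).differentiableAt (by simp))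

/-- `d(k dv) = dk ∧ dv`. -/
lemma extd_smul_fderiv {k v : Pt → ℝ} {q : Pt} (hk : DifferentiableAt ℝ k q)
    (hv : ContDiffAt ℝ ∞ v q) (X Y : Pt) :
    extd (fun z => k z • fderiv ℝ v z) q X Y =
      fderiv ℝ k q X * fderiv ℝ v q Y - fderiv ℝ k q Y * fderiv ℝ v q X := by
  have hsymm : fderiv ℝ (fderiv ℝ v) q X Y = fderiv ℝ (fderiv ℝ v) q Y X :=
    hv.isSymmSndFDerivAt
      (by rw [minSmoothness_of_isRCLikeNormedField]; exact ENat.LEInfty.out) X Y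
  have hd : DifferentiableAt ℝ (fderiv ℝ v) q :=
    (hv.fderiv_right (m := ∞) (by simp)).differentiableAt (by simp)
  simp only [extd, fderiv_fun_smul hk hd]
  simp [hsymm]

/-- `d(k₁ dv₁ + k₂ dv₂) = dk₁ ∧ dv₁ + dk₂ ∧ dv₂`. -/
lemma extd_eq_of_eventuallyEq {α : OneForm} {k₁ v₁ k₂ v₂ : Pt → ℝ} {q : Pt}
    (h : ∀ᶠ z in 𝓝 q, α z = k₁ z • fderiv ℝ v₁ z + k₂ z • fderiv ℝ v₂ z)
    (hk₁ : DifferentiableAt ℝ k₁ q) (hv₁ : ContDiffAt ℝ ∞ v₁ q)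
    (hk₂ : DifferentiableAt ℝ k₂ q) (hv₂ : ContDiffAt ℝ ∞ v₂ q) (X Y : Pt) :
    extd α q X Y =
      (fderiv ℝ k₁ q X * fderiv ℝ v₁ q Y - fderiv ℝ k₁ q Y * fderiv ℝ v₁ q X) +
      (fderiv ℝ k₂ q X * fderiv ℝ v₂ q Y - fderiv ℝ k₂ q Y * fderiv ℝ v₂ q X) := by
  have hcongr : fderiv ℝ α q = _ := Filter.EventuallyEq.fderiv_eq h
  rw [← extd_smul_fderiv hk₁ hv₁, ← extd_smul_fderiv hk₂ hv₂,
    ← extd_add (differentiableAt_smul_fderiv hk₁ hv₁) (differentiableAt_smul_fderiv hk₂ hv₂)]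
  simp only [extd, hcongr]

/-- A functional whose wedge with `B` vanishes is a multiple of `B`. -/
lemma eq_smul_of_wedge_eq_zero {E : Type} [NormedAddCommGroup E] [NormedSpace ℝ E]
    {A B : E →L[ℝ] ℝ} {e : E} (hB : B e ≠ 0) (h : ∀ X Y, A X * B Y = A Y * B X) :
    A = (A e / B e) • B := by
  ext X
  simp only [smul_apply, smul_eq_mul]
  field_simp
  exact h X e

end ExteriorDerivative

end LocalIntegration

/-- **Local integration of the type D, properly CH₁ structure equations** (case `T ≠ 0`):
every solution is locally given by the explicit coframe of the main theorem,
`ω⁰ = e^{2Tw} du`, `ω¹ = 2dw + 4Tx du`, `ω² = e^{−2Tw}(dx + a du)`,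
`ε = e^{−2Tw}(Cx + f(u))`, with
`a = (1 − e^{4Tw})/(2T) + (2T² − C)x² − 2x f(u) + f₁(u)` for free functions `f, f₁`. -/
theorem local_integration_typeD_CH1
    (T C : ℝ) (hT : T ≠ 0) (U : Set Pt) (hU : IsOpen U)
    (ω0 ω1 ω2 : OneForm)
    (hω0 : ContDiffOn ℝ (⊤ : ℕ∞) ω0 U) (hω1 : ContDiffOn ℝ (⊤ : ℕ∞) ω1 U) (hω2 : ContDiffOn ℝ (⊤ : ℕ∞) ω2 U)
    (hindep : ∀ p ∈ U, LinearIndependent ℝ ![ω0 p, ω1 p, ω2 p])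
    (ε P : Pt → ℝ) (hε : ContDiffOn ℝ (⊤ : ℕ∞) ε U) (hP : ContDiffOn ℝ (⊤ : ℕ∞) P U)
    (h0 : ∀ p ∈ U, ∀ X Y, extd ω0 p X Y = -T * wedge ω0 ω1 p X Y)
    (h1 : ∀ p ∈ U, ∀ X Y, extd ω1 p X Y = -(4 * T) * wedge ω0 ω2 p X Y)
    (h2 : ∀ p ∈ U, ∀ X Y, extd ω2 p X Y =
        wedge ω0 ω1 p X Y + 2 * ε p * wedge ω0 ω2 p X Y - T * wedge ω1 ω2 p X Y)
    (hdε : ∀ p ∈ U, fderiv ℝ ε p = P p • ω0 p - (T * ε p) • ω1 p + C • ω2 p) :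
    ∀ p ∈ U, ∃ V : Set Pt, IsOpen V ∧ p ∈ V ∧ V ⊆ U ∧
      ∃ u w x : Pt → ℝ, ∃ f f₁ : ℝ → ℝ,
        ContDiffOn ℝ (⊤ : ℕ∞) u V ∧ ContDiffOn ℝ (⊤ : ℕ∞) w V ∧ ContDiffOn ℝ (⊤ : ℕ∞) x V ∧
        ContDiff ℝ (⊤ : ℕ∞) f ∧ ContDiff ℝ (⊤ : ℕ∞) f₁ ∧
        ∀ q ∈ V,
          ω0 q = exp (2 * T * w q) • fderiv ℝ u q ∧
          ω1 q = (2 : ℝ) • fderiv ℝ w q + (4 * T * x q) • fderiv ℝ u q ∧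
          ω2 q = exp (-(2 * T * w q)) •
            (fderiv ℝ x q +
              ((1 - exp (4 * T * w q)) / (2 * T) + (2 * T ^ 2 - C) * (x q) ^ 2
                - 2 * x q * f (u q) + f₁ (u q)) • fderiv ℝ u q) ∧
          ε q = exp (-(2 * T * w q)) * (C * x q + f (u q)) := by
  intro p hp
  have smooth : ∀ {G : Type} [NormedAddCommGroup G] [NormedSpace ℝ G] {h : Pt → G},
      ContDiffOn ℝ (⊤ : ℕ∞) h U → ∀ q ∈ U, ContDiffAt ℝ (⊤ : ℕ∞) h q :=
    fun hh q hq => hh.contDiffAt (hU.mem_nhds hq)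
  have diff : ∀ {h : Pt → ℝ} {q : Pt}, ContDiffAt ℝ (⊤ : ℕ∞) h q →
      HasFDerivAt h (fderiv ℝ h q) q :=
    fun hh => (hh.differentiableAt (by simp)).hasFDerivAt
  have smoothd : ∀ {h : Pt → ℝ} {q : Pt} (X : Pt), ContDiffAt ℝ (⊤ : ℕ∞) h q →
      ContDiffAt ℝ (⊤ : ℕ∞) (fun z => fderiv ℝ h z X) q :=
    fun X hh => (hh.fderiv_right (m := (⊤ : ℕ∞)) (by simp)).clm_apply contDiffAt_const
  obtain ⟨e, he⟩ : ∃ e, ω0 p e = 1 := by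
    have hne : ω0 p ≠ 0 := (hindep p hp).ne_zero 0
    obtain ⟨X, hX⟩ : ∃ X, ω0 p X ≠ 0 := by
      by_contra! hall
      exact hne (ContinuousLinearMap.ext hall)
    exact ⟨(ω0 p X)⁻¹ • X, by simp [hX]⟩
  obtain ⟨u, hu⟩ := exists_first_integral (α := ω0) (β := fun q => (-T) • ω1 q) hU hω0
    (hω1.continuousOn.const_smul (-T))
    (fun q hq X Y => by
      have := h0 q hq X Y
      simp only [extd, wedge] at this
      rw [this]
      simp
      ring) hp he
  obtain ⟨V, hVu, hVo, hpV⟩ := eventually_nhds_iff.1 (hu.and (hU.eventually_mem hp))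
  have hVn : ∀ q ∈ V, ∀ᶠ z in nhds q, z ∈ V := fun q hq => hVo.mem_nhds hq
  have hVU : ∀ q ∈ V, q ∈ U := fun q hq => (hVu q hq).2
  have hus : ∀ q ∈ V, ContDiffAt ℝ (⊤ : ℕ∞) u q := fun q hq => (hVu q hq).1.1
  have hue : ∀ q ∈ V, fderiv ℝ u q e ≠ 0 := fun q hq => (hVu q hq).1.2.1.ne'
  set g : Pt → ℝ := fun q => ω0 q e / fderiv ℝ u q e with hg
  have hgpos : ∀ q ∈ V, 0 < g q := fun q hq => div_pos (hVu q hq).1.2.2.1 (hVu q hq).1.2.1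
  have hgs : ∀ q ∈ V, ContDiffAt ℝ (⊤ : ℕ∞) g q := fun q hq =>
    ((smooth hω0 q (hVU q hq)).clm_apply contDiffAt_const).div (smoothd e (hus q hq)) (hue q hq)
  have hω0u : ∀ q ∈ V, ω0 q = g q • fderiv ℝ u q := by
    intro q hq
    obtain ⟨⟨-, h3, h4, h5⟩, -⟩ := hVu q hq
    ext X
    have h6 := h5 (X - (ω0 q X / ω0 q e) • e) (by
      simp only [map_sub, map_smul, smul_eq_mul]
      field_simp
      ring)
    simp only [map_sub, map_smul, smul_eq_mul] at h6
    simp only [hg, smul_apply, smul_eq_mul]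
    field_simp at h6 ⊢
    linarith
  set w : Pt → ℝ := fun q => log (g q) / (2 * T) with hw
  have hws : ∀ q ∈ V, ContDiffAt ℝ (⊤ : ℕ∞) w q := fun q hq =>
    ((hgs q hq).log (hgpos q hq).ne').div_const _
  have hgexp : ∀ q ∈ V, exp (2 * T * w q) = g q := by
    intro q hq
    rw [hw]
    simp only
    rw [mul_div_cancel₀ _ (by simpa using hT), exp_log (hgpos q hq)]
  have hdg : ∀ q ∈ V, fderiv ℝ g q = (2 * T * g q) • fderiv ℝ w q := by
    intro q hq
    have h3 := ((diff (hgs q hq)).log (hgpos q hq).ne').mul_const (2 * T)⁻¹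
    have h4 : fderiv ℝ w q = _ := h3.fderiv
    have := (hgpos q hq).ne'
    ext X
    rw [h4]
    simp
    field_simp
  set x : Pt → ℝ := fun q => (ω1 q e - 2 * fderiv ℝ w q e) / (4 * T * fderiv ℝ u q e) with hx
  have hxs : ∀ q ∈ V, ContDiffAt ℝ (⊤ : ℕ∞) x q := fun q hq =>
    (((smooth hω1 q (hVU q hq)).clm_apply contDiffAt_const).sub
      (contDiffAt_const.mul (smoothd e (hws q hq)))).div
      (contDiffAt_const.mul (smoothd e (hus q hq)))
      (mul_ne_zero (by simpa using hT) (hue q hq))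
  have hω1u : ∀ q ∈ V, ω1 q = (2 : ℝ) • fderiv ℝ w q + (4 * T * x q) • fderiv ℝ u q := by
    intro q hq
    have hgq := (hgpos q hq).ne'
    have key := eq_smul_of_wedge_eq_zero (A := ω1 q - (2 : ℝ) • fderiv ℝ w q)
      (B := fderiv ℝ u q) (hue q hq) (fun X Y => by
        have h3 := h0 q (hVU q hq) X Y
        rw [extd_eq_of_eventuallyEq (k₁ := g) (v₁ := u) (k₂ := fun _ => 0) (v₂ := u)
          ((hVn q hq).mono fun z hz => by simp [hω0u z hz])
          (diff (hgs q hq)).differentiableAt (hus q hq) (differentiableAt_const _) (hus q hq),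
          wedge, hω0u q hq, hdg q hq] at h3
        simp at h3 ⊢
        refine mul_left_cancel₀ (mul_ne_zero hT hgq) ?_
        linear_combination -h3)
    rw [sub_eq_iff_eq_add'] at key
    rw [key]
    congr 2
    have := hue q hq
    simp [hx]
    field_simp
  set a : Pt → ℝ := fun q => (g q * ω2 q e - fderiv ℝ x q e) / fderiv ℝ u q e with ha
  have has : ∀ q ∈ V, ContDiffAt ℝ (⊤ : ℕ∞) a q := fun q hq =>
    (((hgs q hq).mul ((smooth hω2 q (hVU q hq)).clm_apply contDiffAt_const)).sub
      (smoothd e (hxs q hq))).div (smoothd e (hus q hq)) (hue q hq)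
  have hω2u : ∀ q ∈ V, ω2 q = (g q)⁻¹ • fderiv ℝ x q + ((g q)⁻¹ * a q) • fderiv ℝ u q := by
    intro q hq
    have hgq := (hgpos q hq).ne'
    have hdx : ∀ X, fderiv ℝ (fun z => 4 * T * x z) q X = 4 * T * fderiv ℝ x q X := by
      intro X
      rw [((diff (hxs q hq)).const_mul (4 * T)).fderiv]
      simp
    have key := eq_smul_of_wedge_eq_zero (A := g q • ω2 q - fderiv ℝ x q)
      (B := fderiv ℝ u q) (hue q hq) (fun X Y => by
        have h3 := h1 q (hVU q hq) X Y
        rw [extd_eq_of_eventuallyEq (k₁ := fun _ => 2) (v₁ := w) (k₂ := fun z => 4 * T * x z)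
          (v₂ := u) ((hVn q hq).mono fun z hz => hω1u z hz)
          (differentiableAt_const _) (hws q hq)
          ((diff (hxs q hq)).const_mul (4 * T)).differentiableAt (hus q hq),
          wedge, hω0u q hq, hdx, hdx] at h3
        simp at h3 ⊢
        refine mul_left_cancel₀ hT ?_
        linear_combination -h3 / 4)
    ext X
    have h4 := congrArg (fun A : Pt →L[ℝ] ℝ => A X) key
    simp at h4 ⊢
    simp only [ha]
    field_simp at h4 ⊢
    linear_combination h4
  have hup : fderiv ℝ u p ((fderiv ℝ u p e)⁻¹ • e) = 1 := by simp [hue p hpV]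
  obtain ⟨f, hf, hfeq⟩ := exists_eventually_eq_comp (u := u) (F := fun q => g q * ε q - C * x q)
    (p := p) ((hVn p hpV).mono hus)
    ((hVn p hpV).mono fun q hq => ((hgs q hq).mul (smooth hε q (hVU q hq))).sub
      (contDiffAt_const.mul (hxs q hq)))
    ((hVn p hpV).mono fun q hq X hX => by
      have hgq := (hgpos q hq).ne'
      have hF : HasFDerivAt (fun q => g q * ε q - C * x q) _ q :=
        ((diff (hgs q hq)).mul (diff (smooth hε q (hVU q hq)))).sub
          ((diff (hxs q hq)).const_mul C)
      rw [hF.fderiv, hdε q (hVU q hq), hdg q hq, hω0u q hq,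
        hω1u q hq, hω2u q hq]
      simp [hX]
      field_simp
      ring) hup
  obtain ⟨V', hV'f, hV'o, hpV'⟩ := eventually_nhds_iff.1 (hfeq.and (hVn p hpV))
  have hV'n : ∀ᶠ z in nhds p, z ∈ V' := hV'o.mem_nhds hpV'
  obtain ⟨f₁, hf₁, hf₁eq⟩ := exists_eventually_eq_comp (u := u)
    (F := fun q => a q + (g q ^ 2 - 1) / (2 * T) - (2 * T ^ 2 - C) * x q ^ 2
      + 2 * (x q * f (u q)))
    (p := p) ((hVn p hpV).mono hus)
    ((hVn p hpV).mono fun q hq => (((has q hq).add ((((hgs q hq).pow 2).sub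
      contDiffAt_const).div_const _)).sub (contDiffAt_const.mul ((hxs q hq).pow 2))).add
      (contDiffAt_const.mul ((hxs q hq).mul (hf.contDiffAt.comp q (hus q hq)))))
    (hV'n.mono fun q hq' X hX => by
      obtain ⟨hfq, hq⟩ := hV'f q hq'
      have hgq := (hgpos q hq).ne'
      have hinv : HasFDerivAt (fun z => (g z)⁻¹) _ q :=
        (hasDerivAt_inv hgq).comp_hasFDerivAt q (diff (hgs q hq))
      have hfu : HasFDerivAt (fun z => f (u z)) (deriv f (u q) • fderiv ℝ u q) q :=
        (hf.differentiable (by simp) (u q)).hasDerivAt.comp_hasFDerivAt q (diff (hus q hq))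
      have hF : HasFDerivAt (fun q => a q + (g q ^ 2 - 1) / (2 * T)
          - (2 * T ^ 2 - C) * x q ^ 2 + 2 * (x q * f (u q))) _ q :=
        (((diff (has q hq)).add ((((diff (hgs q hq)).pow 2).sub_const 1).mul_const
          (2 * T)⁻¹)).sub (((diff (hxs q hq)).pow 2).const_mul _)).add
          (((diff (hxs q hq)).mul hfu).const_mul 2)
      have hia : HasFDerivAt (fun z => (g z)⁻¹ * a z) _ q := hinv.mul (diff (has q hq))
      have h3 := h2 q (hVU q hq) X e
      rw [extd_eq_of_eventuallyEq ((hVn q hq).mono fun z hz => hω2u z hz)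
        hinv.differentiableAt (hxs q hq)
        hia.differentiableAt (hus q hq), hia.fderiv, hinv.fderiv, wedge, wedge, wedge, hdg q hq,
        hω0u q hq, hω1u q hq, hω2u q hq] at h3
      rw [hF.fderiv, hdg q hq]
      have hfq' : f (u q) = g q * ε q - C * x q := hfq.symm
      simp [hX] at h3 ⊢
      rw [hfq']
      refine mul_right_cancel₀ (hue q hq) ?_
      field_simp at h3 ⊢
      linear_combination h3) hup
  obtain ⟨V₁, hV₁, hV₁o, hpV₁⟩ := eventually_nhds_iff.1 (hf₁eq.and hV'n)
  have hV₁V : ∀ q ∈ V₁, q ∈ V := fun q hq => (hV'f q (hV₁ q hq).2).2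
  refine ⟨V₁, hV₁o, hpV₁, fun q hq => hVU q (hV₁V q hq), u, w, x, f, f₁,
    fun q hq => (hus q (hV₁V q hq)).contDiffWithinAt,
    fun q hq => (hws q (hV₁V q hq)).contDiffWithinAt,
    fun q hq => (hxs q (hV₁V q hq)).contDiffWithinAt, hf, hf₁, fun q hq => ?_⟩
  have hqV := hV₁V q hq
  have hgq := (hgpos q hqV).ne'
  have hfq := (hV'f q (hV₁ q hq).2).1
  have hf₁q := (hV₁ q hq).1
  have hexp4 : exp (4 * T * w q) = g q ^ 2 := by
    rw [← hgexp q hqV, ← exp_nat_mul]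
    congr 1
    push_cast
    ring
  rw [exp_neg, hgexp q hqV, hexp4]
  refine ⟨hω0u q hqV, hω1u q hqV, ?_, ?_⟩
  · rw [hω2u q hqV, smul_add, smul_smul, ← hf₁q]
    congr 3
    ring
  · rw [← hfq]
    field_simp
    ring
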